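/- Let Γ be a finite biconnected multigraph with set of bonds 𝓑. For each bond B let U_B ⊆ ℤ^B be the submodule generated by Σ_{e∈B} e, and let U_Γ ⊆ ℤ^{E(Γ)} be the submodule generated by Σ_{e∈E(Γ)} e. For each bond B, the coordinate projection r_B : ℤ^{E(Γ)} → ℤ^B maps U_Γ into U_B, hence its dual induces a ℤ-linear map (ℤ^B/U_B)^∨ → (ℤ^{E(Γ)}/U_Γ)^∨; summing over all bonds gives the map r^∨ : ⊕_{B∈𝓑} (ℤ^B/U_B)^∨ → (ℤ^{E(Γ)}/U_Γ)^∨. Identifying (ℤ^B/U_B)^∨ with {Σ_{e∈B} ℓ_e e^∨ : ℓ_e ∈ ℤ, Σ_{e∈B} ℓ_e = 0}, the kernel of r^∨ is generated by the elements (e_1^∨ − e_2^∨)_{B_1} ⊕ (e_2^∨ − e_1^∨)_{B_2}, for all bonds B_1, B_2 and all e_1, e_2 ∈ B_1 ∩ B_2, together with the elements (e_1^∨ − e_2^∨)_{B_1} ⊕ (e_2^∨ − e_3^∨)_{B_2} ⊕ (e_3^∨ − e_1^∨)_{B_3}, for all bonds B_1 = E(V_1, V_1^c), B_2 = E(V_2,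 V_2^c), B_3 = E(V_1 ∪ V_2, V_1^c ∩ V_2^c) with V_1 ∩ V_2 = ∅ and all e_1 ∈ B_1 ∩ B_3, e_2 ∈ B_1 ∩ B_2, e_3 ∈ B_2 ∩ B_3 (components in bonds other than those displayed being zero). -/

import Mathlib

/-- A finite multigraph: finitely many vertices and edges, each edge has two
(ordered, possibly equal) endpoints; loops and multiple edges are allowed. -/
structure Multigraph where
  V : Type
  E : Type
  [finV : Finite V]
  [finE : Finite E]
  fst : E → V
  snd : E → V

attribute [instance] Multigraph.finV Multigraph.finE

namespace Multigraph

variable (Γ : Multigraph)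

/-- `v` is an endpoint of the edge `e`. -/
def Inc (v : Γ.V) (e : Γ.E) : Prop := Γ.fst e = v ∨ Γ.snd e = v

/-- `e` is a loop. -/
def IsLoop (e : Γ.E) : Prop := Γ.fst e = Γ.snd e

/-- Adjacency inside the induced subgraph on the vertex set `W`. -/
def AdjOn (W : Set Γ.V) (a b : Γ.V) : Prop :=
  a ∈ W ∧ b ∈ W ∧ ∃ e : Γ.E, (Γ.fst e = a ∧ Γ.snd e = b) ∨ (Γ.fst e = b ∧ Γ.snd e = a)

/-- The induced subgraph on `W` is (nonempty and) connected. -/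
def ConnectedOn (W : Set Γ.V) : Prop :=
  W.Nonempty ∧ ∀ a ∈ W, ∀ b ∈ W, Relation.ReflTransGen (Γ.AdjOn W) a b

/-- `Γ` is connected. -/
def Connected : Prop := Γ.ConnectedOn Set.univ

/-- A separating vertex: its removal disconnects the graph; moreover a vertex
carrying a loop is separating provided at least one other edge is attached to it. -/
def SeparatingVertex (v : Γ.V) : Prop :=
  ({w : Γ.V | w ≠ v}.Nonempty ∧ ¬ Γ.ConnectedOn {w : Γ.V | w ≠ v}) ∨
  (∃ e₁ e₂ : Γ.E, e₁ ≠ e₂ ∧ Γ.IsLoop e₁ ∧ Γ.Inc v e₁ ∧ Γ.Inc v e₂)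

/-- `Γ` is biconnected: connected and without separating vertices. -/
def Biconnected : Prop := Γ.Connected ∧ ∀ v : Γ.V, ¬ Γ.SeparatingVertex v

/-- The set `E(W, Wᶜ)` of edges joining a vertex of `W` to a vertex outside `W` (a *cut*). -/
def crossEdges (W : Set Γ.V) : Set Γ.E :=
  {e | (Γ.fst e ∈ W ∧ Γ.snd e ∉ W) ∨ (Γ.snd e ∈ W ∧ Γ.fst e ∉ W)}

/-- `W` determines a bond: a nontrivial partition `W ∪ Wᶜ` with both induced subgraphs
connected. -/
def IsBondOn (W : Set Γ.V) : Prop :=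
  W.Nonempty ∧ Wᶜ.Nonempty ∧ Γ.ConnectedOn W ∧ Γ.ConnectedOn Wᶜ

/-- A bond: a minimal cut. -/
def IsBond (B : Set Γ.E) : Prop := ∃ W : Set Γ.V, Γ.IsBondOn W ∧ B = Γ.crossEdges W

/-- The subgraph consisting of the edges in `F` together with their endpoints. -/
def edgeSubgraph (F : Set Γ.E) : Multigraph where
  V := {v : Γ.V // ∃ e ∈ F, Γ.Inc v e}
  E := {e : Γ.E // e ∈ F}
  fst := fun e => ⟨Γ.fst e.1, e.1, e.2, Or.inl rfl⟩
  snd := fun e => ⟨Γ.snd e.1, e.1, e.2, Or.inr rfl⟩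

/-- A biconnected component: a maximal set of edges inducing a biconnected subgraph. -/
def IsBicomponent (F : Set Γ.E) : Prop :=
  (Γ.edgeSubgraph F).Biconnected ∧
    ∀ F' : Set Γ.E, F ⊆ F' → (Γ.edgeSubgraph F').Biconnected → F' = F

/-- The contraction `Γ/S` of `Γ`: all the edges in `S` are contracted; the remaining
edges are `E(Γ) \ S`. -/
def contract (S : Set Γ.E) : Multigraph where
  V := Quot (fun a b : Γ.V => ∃ e ∈ S, Γ.fst e = a ∧ Γ.snd e = b)
  E := {e : Γ.E // e ∉ S}
  fst := fun e => Quot.mk _ (Γ.fst e.1)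
  snd := fun e => Quot.mk _ (Γ.snd e.1)

/-- Enriched graphs (Abreu–Pacini): `p` is an enriched structure on `Γ`, i.e. a
preorder on the edges satisfying the recursive conditions (1), (2), (3). -/
inductive IsEnriched : ∀ G : Multigraph, (G.E → G.E → Prop) → Prop
  | of_subsingleton (G : Multigraph) (p : G.E → G.E → Prop)
      (hrefl : Reflexive p) (htrans : Transitive p) (hsub : Subsingleton G.E) :
      IsEnriched G p
  | of_biconnected (G : Multigraph) (p : G.E → G.E → Prop)
      (hrefl : Reflexive p) (htrans : Transitive p)
      (hbic : G.Biconnected) (S : Set G.E) (hne : S.Nonempty)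
      (hlow : ∀ e e' : G.E, p e e' → e' ∈ S → e ∈ S)
      (hmin : ∀ e ∈ S, ∀ e' : G.E, p e e')
      (hrec : IsEnriched (G.contract S) (fun a b => p a.1 b.1)) :
      IsEnriched G p
  | of_separating (G : Multigraph) (p : G.E → G.E → Prop)
      (hrefl : Reflexive p) (htrans : Transitive p)
      (hsep : ∃ v : G.V, G.SeparatingVertex v)
      (hcomp : ∀ F : Set G.E, G.IsBicomponent F →
        IsEnriched (G.edgeSubgraph F) (fun a b => p a.1 b.1))
      (hincomp : ∀ F F' : Set G.E, G.IsBicomponent F → G.IsBicomponent F' → F ≠ F' →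
        ∀ e ∈ F, ∀ e' ∈ F', ¬ p e e') :
      IsEnriched G p

/-- `a ∼ₚ b`. -/
def Esim (p : Γ.E → Γ.E → Prop) (a b : Γ.E) : Prop := p a b ∧ p b a

/-- `a <ₚ b`. -/
def StrictBelow (p : Γ.E → Γ.E → Prop) (a b : Γ.E) : Prop := p a b ∧ ¬ p b a

/-- The classes of `a` and `b` are consecutive (with `a` below `b`). -/
def Consecutive (p : Γ.E → Γ.E → Prop) (a b : Γ.E) : Prop :=
  StrictBelow Γ p a b ∧ ∀ c : Γ.E, ¬ (StrictBelow Γ p a c ∧ StrictBelow Γ p c b)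

/-- The specialization `(Γ, p) ⇝ (Γ, p')` (same underlying graph, `S = ∅`). -/
def SpecializesSame (p p' : Γ.E → Γ.E → Prop) : Prop :=
  IsEnriched Γ p ∧ IsEnriched Γ p' ∧ ∀ e e' : Γ.E, p e e' → p' e e'

/-- The specialization `(Γ, p) ⇝ (Γ/S, p')`. -/
def Specializes (p : Γ.E → Γ.E → Prop) (S : Set Γ.E)
    (p' : (Γ.contract S).E → (Γ.contract S).E → Prop) : Prop :=
  IsEnriched Γ p ∧ IsEnriched (Γ.contract S) p' ∧
  (∀ e e' : Γ.E, p e e' → e' ∈ S → e ∈ S) ∧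
  (∀ (e e' : Γ.E) (he : e ∉ S) (he' : e' ∉ S), p e e' → p' ⟨e, he⟩ ⟨e', he'⟩)

/-- A simple specialization `(Γ, p) ⇝ (Γ, p')`: it merges two consecutive classes. -/
def IsSimpleSpec (p p' : Γ.E → Γ.E → Prop) : Prop :=
  SpecializesSame Γ p p' ∧ ∃ e₁ e₂ : Γ.E, Consecutive Γ p e₁ e₂ ∧
    ∀ e e' : Γ.E, p' e e' ↔ p e e' ∨
      ((Esim Γ p e e₁ ∨ Esim Γ p e e₂) ∧ (Esim Γ p e' e₁ ∨ Esim Γ p e' e₂))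

/-- `rank(p)`: the number of equivalence classes of edges. -/
noncomputable def rank (p : Γ.E → Γ.E → Prop) : ℕ := Nat.card (Quot (Esim Γ p))

/-- The (relatively open) cone `K(Γ, p) ⊆ ℝ^{E(Γ)}`. -/
def K (p : Γ.E → Γ.E → Prop) : Set (Γ.E → ℝ) :=
  {x | (∀ e, 0 < x e) ∧ ∀ e e' : Γ.E, p e e' → x e ≤ x e' ∧ (x e = x e' ↔ p e' e)}

open Classical in
/-- The injective linear map `ī : ℝ^{E(Γ/S)} → ℝ^{E(Γ)}` (extension by zero). -/
noncomputable def extendZero (S : Set Γ.E) (y : (Γ.contract S).E → ℝ) : Γ.E → ℝ :=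
  fun e => if h : e ∈ S then 0 else y ⟨e, h⟩

end Multigraph

/-- A face of a closed convex cone `σ`: either `σ` itself, or `σ ∩ ker ℓ` for a linear
functional `ℓ` which is nonnegative on `σ`. -/
def IsFaceOf {α : Type} (σ F : Set (α → ℝ)) : Prop :=
  F = σ ∨ ∃ ℓ : (α → ℝ) →ₗ[ℝ] ℝ, (∀ x ∈ σ, 0 ≤ ℓ x) ∧ F = σ ∩ {x | ℓ x = 0}

open Classical in
/-- The Kronecker delta on edges. -/
noncomputable def Multigraph.kdelta (Γ : Multigraph) (a b : Γ.E) : ℤ :=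
  if a = b then 1 else 0

open Classical in
/-- The type-1 generator `(e₁^∨ − e₂^∨)_{B₁} ⊕ (e₂^∨ − e₁^∨)_{B₂}`. -/
noncomputable def Multigraph.gen1 (Γ : Multigraph) (B₁ B₂ : Set Γ.E) (e₁ e₂ : Γ.E) :
    Set Γ.E → Γ.E → ℤ :=
  fun B e =>
    (if B = B₁ then Γ.kdelta e₁ e - Γ.kdelta e₂ e else 0) +
    (if B = B₂ then Γ.kdelta e₂ e - Γ.kdelta e₁ e else 0)

open Classical in
/-- The type-2 generator
`(e₁^∨ − e₂^∨)_{B₁} ⊕ (e₂^∨ − e₃^∨)_{B₂} ⊕ (e₃^∨ − e₁^∨)_{B₃}`. -/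
noncomputable def Multigraph.gen2 (Γ : Multigraph) (B₁ B₂ B₃ : Set Γ.E)
    (e₁ e₂ e₃ : Γ.E) : Set Γ.E → Γ.E → ℤ :=
  fun B e =>
    (if B = B₁ then Γ.kdelta e₁ e - Γ.kdelta e₂ e else 0) +
    (if B = B₂ then Γ.kdelta e₂ e - Γ.kdelta e₃ e else 0) +
    (if B = B₃ then Γ.kdelta e₃ e - Γ.kdelta e₁ e else 0)

namespace Multigraph

variable {Γ : Multigraph}

/-- `a` and `b` are the two endpoints of some edge. -/
def Adj (Γ : Multigraph) (a b : Γ.V) : Prop :=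
  ∃ e : Γ.E, (Γ.fst e = a ∧ Γ.snd e = b) ∨ (Γ.fst e = b ∧ Γ.snd e = a)

lemma Adj.symm {a b : Γ.V} (h : Γ.Adj a b) : Γ.Adj b a := by
  obtain ⟨e, h⟩ := h
  exact ⟨e, h.symm⟩

lemma AdjOn.symm {W : Set Γ.V} {a b : Γ.V} (h : Γ.AdjOn W a b) : Γ.AdjOn W b a :=
  ⟨h.2.1, h.1, Adj.symm h.2.2⟩

lemma reflTransGen_adjOn_symm {W : Set Γ.V} {a b : Γ.V}
    (h : Relation.ReflTransGen (Γ.AdjOn W) a b) : Relation.ReflTransGen (Γ.AdjOn W) b a := by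
  induction h with
  | refl => exact .refl
  | tail _ h ih => exact .head h.symm ih

lemma reflTransGen_adjOn_mono {W W' : Set Γ.V} (hW : W ⊆ W') {a b : Γ.V}
    (h : Relation.ReflTransGen (Γ.AdjOn W) a b) : Relation.ReflTransGen (Γ.AdjOn W') a b :=
  Relation.ReflTransGen.mono (fun _ _ h => ⟨hW h.1, hW h.2.1, h.2.2⟩) _ _ h

lemma connectedOn_of_root {W : Set Γ.V} {r : Γ.V} (hr : r ∈ W)
    (h : ∀ a ∈ W, Relation.ReflTransGen (Γ.AdjOn W) a r) : Γ.ConnectedOn W :=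
  ⟨⟨r, hr⟩, fun a ha b hb => (h a ha).trans (reflTransGen_adjOn_symm (h b hb))⟩

lemma connectedOn_singleton (v : Γ.V) : Γ.ConnectedOn {v} :=
  connectedOn_of_root rfl fun a ha => by
    obtain rfl : a = v := ha
    exact .refl

lemma ConnectedOn.union {A B : Set Γ.V} (hA : Γ.ConnectedOn A) (hB : Γ.ConnectedOn B)
    {a b : Γ.V} (ha : a ∈ A) (hb : b ∈ B) (hab : Γ.Adj a b) : Γ.ConnectedOn (A ∪ B) := by
  refine connectedOn_of_root (Or.inl ha) ?_
  rintro x (hx | hx)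
  · exact reflTransGen_adjOn_mono Set.subset_union_left (hA.2 x hx a ha)
  · exact (reflTransGen_adjOn_mono Set.subset_union_right (hB.2 x hx b hb)).tail
      ⟨Or.inr hb, Or.inl ha, hab.symm⟩

lemma ConnectedOn.exists_adj {W A : Set Γ.V} (hW : Γ.ConnectedOn W) {a b : Γ.V}
    (haW : a ∈ W) (ha : a ∈ A) (hbW : b ∈ W) (hb : b ∉ A) :
    ∃ x ∈ W, ∃ z ∈ W, x ∈ A ∧ z ∉ A ∧ Γ.Adj x z := by
  by_contra! hcon
  refine hb ?_
  have h := hW.2 a haW b hbW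
  clear hb hbW
  induction h with
  | refl => exact ha
  | tail _ h ih => by_contra hc; exact hcon _ h.1 _ h.2.1 ih hc h.2.2

/-- In a connected `W`, the component `K` of `d` in `W \ {c}` and its complement in `W` are both
connected, and `K` is joined inside `W` only to `c`. -/
lemma ConnectedOn.exists_component {W : Set Γ.V} (hW : Γ.ConnectedOn W) {c d : Γ.V}
    (hc : c ∈ W) (hd : d ∈ W) (hcd : d ≠ c) :
    ∃ K ⊆ W, d ∈ K ∧ c ∉ K ∧ Γ.ConnectedOn K ∧ Γ.ConnectedOn (W \ K) ∧
      ∀ x ∈ K, ∀ z ∈ W, Γ.Adj x z → z ∈ K ∨ z = c := by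
  set K : Set Γ.V := {x | Relation.ReflTransGen (Γ.AdjOn (W \ {c})) d x} with hK
  have hKW : ∀ x ∈ K, x ∈ W \ {c} := by
    intro x hx
    rcases Relation.ReflTransGen.cases_tail hx with h | ⟨y, _, h⟩
    · exact h ▸ ⟨hd, hcd⟩
    · exact h.2.1
  have hclosed : ∀ x ∈ K, ∀ z ∈ W, Γ.Adj x z → z ∈ K ∨ z = c := by
    intro x hx z hz hxz
    by_cases hzc : z = c
    · exact Or.inr hzc
    · exact Or.inl (Relation.ReflTransGen.tail hx ⟨hKW x hx, ⟨hz, hzc⟩, hxz⟩)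
  have hcK : c ∉ K := fun h => (hKW c h).2 rfl
  have hdK : d ∈ K := Relation.ReflTransGen.refl
  refine ⟨K, fun x hx => (hKW x hx).1, hdK, hcK, ?_, ?_, hclosed⟩
  · refine connectedOn_of_root hdK fun a ha => reflTransGen_adjOn_symm ?_
    have h : Relation.ReflTransGen (Γ.AdjOn (W \ {c})) d a := ha
    clear ha
    induction h with
    | refl => exact .refl
    | tail h h' ih => exact ih.tail ⟨h, h.tail h', h'.2.2⟩
  · refine connectedOn_of_root ⟨hc, hcK⟩ fun a ha => ?_
    have h := hW.2 a ha.1 c hc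
    induction h using Relation.ReflTransGen.head_induction_on with
    | refl => exact .refl
    | @head x z h _ ih =>
      by_cases hxc : x = c
      · exact hxc ▸ .refl
      · have hz : z ∉ K := fun hz => (hclosed z hz x h.1 (Adj.symm h.2.2)).elim ha.2 hxc
        exact .head ⟨ha, ⟨h.2.1, hz⟩, h.2.2⟩ (ih ⟨h.2.1, hz⟩)

lemma Biconnected.connectedOn_ne (hΓ : Γ.Biconnected) {v w : Γ.V} (h : w ≠ v) :
    Γ.ConnectedOn {w : Γ.V | w ≠ v} := by
  by_contra hc
  exact hΓ.2 v (Or.inl ⟨⟨w, h⟩, hc⟩)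

/-- Some vertex of `A` is adjacent to a vertex outside `X`. -/
def Touches (Γ : Multigraph) (A X : Set Γ.V) : Prop := ∃ a ∈ A, ∃ y ∉ X, Γ.Adj a y

/-- `X` is the disjoint union of two connected sets which separate `u` from `v` and are both
joined to the complement of `X`. -/
def Splits (Γ : Multigraph) (X : Set Γ.V) (u v : Γ.V) : Prop :=
  ∃ P ⊆ X, u ∈ P ∧ v ∈ X \ P ∧ Γ.ConnectedOn P ∧ Γ.ConnectedOn (X \ P) ∧
    Γ.Touches P X ∧ Γ.Touches (X \ P) X

lemma Splits.symm {X : Set Γ.V} {u v : Γ.V} (h : Γ.Splits X u v) : Γ.Splits X v u := by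
  obtain ⟨P, hP, hu, hv, h₁, h₂, h₃, h₄⟩ := h
  have hPP : X \ (X \ P) = P := Set.sdiff_sdiff_cancel_left hP
  refine ⟨X \ P, Set.sdiff_subset, hv, ?_, h₂, ?_, h₄, ?_⟩ <;> rw [hPP] <;> assumption

lemma Splits.step (hΓ : Γ.Biconnected) {X : Set Γ.V} {u v w : Γ.V} (h : Γ.Splits X u v)
    (huv : Γ.Adj u v) (hw : w ∈ X) (hwv : w ≠ v) : Γ.Splits X v w := by
  obtain ⟨P, hP, hu, hv, h₁, h₂, h₃, h₄⟩ := id h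
  by_cases hwP : w ∈ P
  · exact Splits.symm ⟨P, hP, hwP, hv, h₁, h₂, h₃, h₄⟩
  obtain ⟨K, hKX, hwK, hvK, hK, hK', hKc⟩ := h₂.exists_component hv ⟨hw, hwP⟩ hwv
  have huK : u ∉ K := fun h => (hKX h).2 hu
  by_cases hKt : Γ.Touches K X
  · have hXK : X \ K = P ∪ ((X \ P) \ K) := by
      ext x
      have h1 : x ∈ P → x ∈ X := fun h => hP h
      have h2 : x ∈ K → x ∉ P := fun h => (hKX h).2
      simp only [Set.mem_sdiff, Set.mem_union]
      tauto
    refine Splits.symm ⟨K, fun x hx => (hKX hx).1, hwK, ⟨hv.1, hvK⟩, hK, ?_, hKt, ?_⟩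
    · rw [hXK]
      exact h₁.union hK' hu ⟨hv, hvK⟩ huv
    · obtain ⟨p, hp, y, hy, hpy⟩ := h₃
      exact ⟨p, ⟨hP hp, fun h => (hKX h).2 hp⟩, y, hy, hpy⟩
  · have huv' : u ≠ v := fun h => hv.2 (h ▸ hu)
    obtain ⟨x, -, z, hzv, hx, hz, hxz⟩ :=
      (hΓ.connectedOn_ne hwv).exists_adj (A := K) hwv hwK huv' huK
    have hzX : z ∈ X := by
      by_contra hzX
      exact hKt ⟨x, hx, z, hzX, hxz⟩
    have hzP : z ∈ P := by
      by_contra hzP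
      exact (hKc x hx z ⟨hzX, hzP⟩ hxz).elim hz hzv
    refine Splits.symm ⟨P ∪ K, Set.union_subset hP fun x hx => (hKX hx).1, Or.inr hwK,
      ⟨hv.1, fun h => h.elim hv.2 hvK⟩, h₁.union hK hzP hx hxz.symm, ?_, ?_, ?_⟩
    · rwa [← Set.sdiff_sdiff]
    · obtain ⟨p, hp, y, hy, hpy⟩ := h₃
      exact ⟨p, Or.inl hp, y, hy, hpy⟩
    · obtain ⟨p, hp, y, hy, hpy⟩ := h₄
      exact ⟨p, ⟨hp.1, fun h => h.elim hp.2 fun h => hKt ⟨p, h, y, hy, hpy⟩⟩, y, hy, hpy⟩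

lemma IsBondOn.compl {X : Set Γ.V} (h : Γ.IsBondOn X) : Γ.IsBondOn Xᶜ := by
  obtain ⟨h₁, h₂, h₃, h₄⟩ := h
  refine ⟨h₂, ?_, h₄, ?_⟩ <;> rwa [compl_compl]

lemma crossEdges_compl (X : Set Γ.V) : Γ.crossEdges Xᶜ = Γ.crossEdges X := by
  ext e
  simp only [crossEdges, Set.mem_ofPred_eq, Set.mem_compl_iff]
  tauto

/-- Any two vertices of the side `X` of a bond are separated by a splitting of `X`. -/
lemma IsBondOn.splits (hΓ : Γ.Biconnected) {X : Set Γ.V} (hX : Γ.IsBondOn X) {u v : Γ.V}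
    (hu : u ∈ X) (hv : v ∈ X) (huv : u ≠ v) : Γ.Splits X u v := by
  obtain ⟨-, ⟨y, hy⟩, hXc, -⟩ := hX
  obtain ⟨c, -, z, -, hc, hz, hcz⟩ := hΓ.1.exists_adj (A := X) trivial hu trivial hy
  obtain ⟨c', hc', hc'c⟩ : ∃ c' ∈ X, c' ≠ c := by
    by_cases h : u = c
    · exact ⟨v, hv, fun h' => huv (h.trans h'.symm)⟩
    · exact ⟨u, hu, h⟩
  have hyc : y ≠ c := fun h => hy (h ▸ hc)
  obtain ⟨d, hdc, z', -, hd, hz', hdz'⟩ :=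
    (hΓ.connectedOn_ne hc'c).exists_adj (A := X) hc'c hc' hyc hy
  obtain ⟨K, hKX, hdK, hcK, hK, hK', -⟩ := hXc.exists_component hc hd hdc
  have hsplit : ∀ u₀ ∈ K, ∀ v₀ ∈ X \ K, Γ.Splits X u₀ v₀ := fun u₀ hu₀ v₀ hv₀ =>
    ⟨K, hKX, hu₀, hv₀, hK, hK', ⟨d, hdK, z', hz', hdz'⟩, c, ⟨hc, hcK⟩, z, hz, hcz⟩
  obtain ⟨u₀, -, v₀, hv₀X, hu₀, hv₀, hadj₀⟩ := hXc.exists_adj (A := K) hd hdK hc hcK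
  have key : ∀ x, Relation.ReflTransGen (Γ.AdjOn X) v₀ x →
      ∀ w ∈ X, w ≠ x → Γ.Splits X x w := by
    intro x hx
    induction hx with
    | refl => exact fun w hw hwv => (hsplit u₀ hu₀ v₀ ⟨hv₀X, hv₀⟩).step hΓ hadj₀ hw hwv
    | tail _ h ih =>
      rename_i b e _
      by_cases hbe : e = b
      · rwa [hbe]
      · exact fun w hw hwe => (ih e h.2.1 hbe).step hΓ h.2.2 hw hwe
  exact key u (hXc.2 v₀ hv₀X u hu) v hv huv.symm

/-- `e` joins a vertex of `P` with a vertex of `Q`. -/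
def Joins (Γ : Multigraph) (e : Γ.E) (P Q : Set Γ.V) : Prop :=
  (Γ.fst e ∈ P ∧ Γ.snd e ∈ Q) ∨ (Γ.snd e ∈ P ∧ Γ.fst e ∈ Q)

lemma Joins.symm {e : Γ.E} {P Q : Set Γ.V} (h : Γ.Joins e P Q) : Γ.Joins e Q P := by
  unfold Joins at *
  tauto

lemma Joins.mem_crossEdges {e : Γ.E} {P Q W : Set Γ.V} (h : Γ.Joins e P Q) (hP : P ⊆ W)
    (hQ : Disjoint Q W) : e ∈ Γ.crossEdges W := by
  rw [Set.disjoint_left] at hQ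
  rcases h with h | h
  · exact Or.inl ⟨hP h.1, hQ h.2⟩
  · exact Or.inr ⟨hP h.1, hQ h.2⟩

/-- A bond `X` together with an edge inside `X` refines to a tripartition `Xᶜ, P, Q` all of whose
pairwise unions are connected, with the given edge joining `P` and `Q`. -/
lemma IsBondOn.exists_tripartition (hΓ : Γ.Biconnected) {X : Set Γ.V} (hX : Γ.IsBondOn X)
    {e : Γ.E} (h₁ : Γ.fst e ∈ X) (h₂ : Γ.snd e ∈ X) (he : ¬ Γ.IsLoop e) :
    ∃ P Q : Set Γ.V, P ∪ Q = X ∧ Disjoint P Q ∧ Γ.IsBondOn P ∧ Γ.IsBondOn Q ∧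
      Γ.Joins e P Q := by
  obtain ⟨P, hPX, hu, hv, hP, hQ, ⟨p, hp, y, hy, hpy⟩, ⟨q, hq, z, hz, hqz⟩⟩ :=
    hX.splits hΓ h₁ h₂ he
  have hPc : Pᶜ = (X \ P) ∪ Xᶜ := by
    ext x
    have : x ∈ P → x ∈ X := fun h => hPX h
    simp only [Set.mem_sdiff, Set.mem_union, Set.mem_compl_iff]
    tauto
  have hQc : (X \ P)ᶜ = P ∪ Xᶜ := by
    ext x
    simp only [Set.mem_sdiff, Set.mem_union, Set.mem_compl_iff]
    tauto
  refine ⟨P, X \ P, Set.union_sdiff_cancel hPX, Set.disjoint_sdiff_right,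
    ⟨hP.1, ⟨_, hv.2⟩, hP, ?_⟩, ⟨hQ.1, ⟨_, fun h => h.2 hu⟩, hQ, ?_⟩, Or.inl ⟨hu, hv⟩⟩
  · rw [hPc]
    exact hQ.union hX.2.2.2 hq hz hqz
  · rw [hQc]
    exact hP.union hX.2.2.2 hp hy hpy

lemma not_isLoop_of_mem_crossEdges {W : Set Γ.V} {e : Γ.E} (h : e ∈ Γ.crossEdges W) :
    ¬ Γ.IsLoop e := by
  intro hl
  unfold IsLoop at hl
  rcases h with h | h
  · exact h.2 (hl ▸ h.1)
  · exact h.2 (hl ▸ h.1)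

lemma mem_or_mem_of_notMem_crossEdges {W : Set Γ.V} {e : Γ.E} (h : e ∉ Γ.crossEdges W) :
    (Γ.fst e ∈ W ∧ Γ.snd e ∈ W) ∨ (Γ.fst e ∈ Wᶜ ∧ Γ.snd e ∈ Wᶜ) := by
  simp only [crossEdges, Set.mem_ofPred_eq, Set.mem_compl_iff] at *
  tauto

lemma Biconnected.isBondOn_singleton (hΓ : Γ.Biconnected) {v w : Γ.V} (h : w ≠ v) :
    Γ.IsBondOn {v} :=
  ⟨⟨v, rfl⟩, ⟨w, h⟩, connectedOn_singleton v, hΓ.connectedOn_ne h⟩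

/-- Any edge crossing the side `X = P ∪ Q` of a bond meets `P` or `Q`. -/
lemma joins_or_joins {X P Q : Set Γ.V} {e : Γ.E} (hPQ : P ∪ Q = X) (he : e ∈ Γ.crossEdges X) :
    Γ.Joins e P Xᶜ ∨ Γ.Joins e Q Xᶜ := by
  subst hPQ
  simp only [crossEdges, Joins, Set.mem_ofPred_eq, Set.mem_compl_iff, Set.mem_union] at *
  tauto

/-- Two edges of a biconnected graph lie in a common bond. -/
lemma Biconnected.exists_isBond (hΓ : Γ.Biconnected) {e f : Γ.E} (he : ¬ Γ.IsLoop e)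
    (hf : ¬ Γ.IsLoop f) : ∃ B, Γ.IsBond B ∧ e ∈ B ∧ f ∈ B := by
  have hX := hΓ.isBondOn_singleton (Ne.symm he)
  have heX : e ∈ Γ.crossEdges {Γ.fst e} := Or.inl ⟨rfl, fun h => he h.symm⟩
  by_cases hfX : f ∈ Γ.crossEdges {Γ.fst e}
  · exact ⟨_, ⟨_, hX, rfl⟩, heX, hfX⟩
  rcases mem_or_mem_of_notMem_crossEdges hfX with h | h
  · exact absurd (h.1.trans h.2.symm) hf
  obtain ⟨P, Q, hPQ, hd, hP, hQ, hfPQ⟩ := hX.compl.exists_tripartition hΓ h.1 h.2 hf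
  rw [← crossEdges_compl] at heX
  have hPd : Disjoint {Γ.fst e}ᶜᶜ P :=
    Set.disjoint_compl_left_iff_subset.2 (hPQ ▸ Set.subset_union_left)
  have hQd : Disjoint {Γ.fst e}ᶜᶜ Q :=
    Set.disjoint_compl_left_iff_subset.2 (hPQ ▸ Set.subset_union_right)
  rcases joins_or_joins hPQ heX with h' | h'
  · exact ⟨_, ⟨P, hP, rfl⟩, h'.mem_crossEdges subset_rfl hPd,
      hfPQ.mem_crossEdges subset_rfl hd.symm⟩
  · exact ⟨_, ⟨Q, hQ, rfl⟩, h'.mem_crossEdges subset_rfl hQd,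
      hfPQ.symm.mem_crossEdges subset_rfl hd⟩

/-- `V₁`, `V₂` and `(V₁ ∪ V₂)ᶜ` form a tripartition with connected parts and connected pairwise
unions, and `e₁`, `e₂`, `e₃` join its three pairs of parts. -/
def IsTriangle (Γ : Multigraph) (V₁ V₂ : Set Γ.V) (e₁ e₂ e₃ : Γ.E) : Prop :=
  V₁ ∩ V₂ = ∅ ∧ Γ.IsBondOn V₁ ∧ Γ.IsBondOn V₂ ∧ Γ.IsBondOn (V₁ ∪ V₂) ∧
    e₁ ∈ Γ.crossEdges V₁ ∩ Γ.crossEdges (V₁ ∪ V₂) ∧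
    e₂ ∈ Γ.crossEdges V₁ ∩ Γ.crossEdges V₂ ∧
    e₃ ∈ Γ.crossEdges V₂ ∩ Γ.crossEdges (V₁ ∪ V₂)

lemma isTriangle_of_joins {X P Q : Set Γ.V} {e₁ e₂ e₃ : Γ.E} (hX : Γ.IsBondOn X)
    (hP : Γ.IsBondOn P) (hQ : Γ.IsBondOn Q) (hPQ : P ∪ Q = X) (hd : Disjoint P Q)
    (h₁ : Γ.Joins e₁ P Xᶜ) (h₂ : Γ.Joins e₂ Q Xᶜ) (h₃ : Γ.Joins e₃ P Q) :
    Γ.IsTriangle Xᶜ Q e₁ e₂ e₃ := by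
  have hPX : P ⊆ X := hPQ ▸ Set.subset_union_left
  have hQX : Q ⊆ X := hPQ ▸ Set.subset_union_right
  have hXQ : Xᶜ ∪ Q = Pᶜ := by
    ext x
    have h1 : x ∈ P → x ∉ Q := fun h h' => Set.disjoint_left.1 hd h h'
    subst hPQ
    simp only [Set.mem_union, Set.mem_compl_iff]
    tauto
  have hPXc : Disjoint Xᶜ P := Set.disjoint_compl_left_iff_subset.2 hPX
  have hQXc : Disjoint Xᶜ Q := Set.disjoint_compl_left_iff_subset.2 hQX
  refine ⟨hQXc.inter_eq, hX.compl, hQ, hXQ ▸ hP.compl, ?_, ?_, ?_⟩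
  · rw [hXQ, crossEdges_compl P]
    exact ⟨h₁.symm.mem_crossEdges subset_rfl hPXc.symm, h₁.mem_crossEdges subset_rfl hPXc⟩
  · exact ⟨h₂.symm.mem_crossEdges subset_rfl hQXc.symm, h₂.mem_crossEdges subset_rfl hQXc⟩
  · rw [hXQ, crossEdges_compl P]
    exact ⟨h₃.symm.mem_crossEdges subset_rfl hd, h₃.mem_crossEdges subset_rfl hd.symm⟩

/-- Three edges of a biconnected graph lie in a common bond or form a triangle in a contraction. -/
lemma Biconnected.exists_isBond_or_isTriangle (hΓ : Γ.Biconnected) {e₁ e₂ e₃ : Γ.E}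
    (h₁ : ¬ Γ.IsLoop e₁) (h₂ : ¬ Γ.IsLoop e₂) (h₃ : ¬ Γ.IsLoop e₃) :
    (∃ B, Γ.IsBond B ∧ e₁ ∈ B ∧ e₂ ∈ B ∧ e₃ ∈ B) ∨
      ∃ V₁ V₂, Γ.IsTriangle V₁ V₂ e₁ e₂ e₃ := by
  obtain ⟨_, ⟨X, hX, rfl⟩, he₁, he₂⟩ := hΓ.exists_isBond h₁ h₂
  by_cases he₃ : e₃ ∈ Γ.crossEdges X
  · exact Or.inl ⟨_, ⟨X, hX, rfl⟩, he₁, he₂, he₃⟩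
  wlog h : Γ.fst e₃ ∈ X ∧ Γ.snd e₃ ∈ X generalizing X
  · have h' := (mem_or_mem_of_notMem_crossEdges he₃).resolve_left h
    rw [← crossEdges_compl] at he₁ he₂ he₃
    exact this _ hX.compl he₁ he₂ he₃ h'
  obtain ⟨P, Q, hPQ, hd, hP, hQ, hj⟩ := hX.exists_tripartition hΓ h.1 h.2 h₃
  have hPd : Disjoint Xᶜ P :=
    Set.disjoint_compl_left_iff_subset.2 (hPQ ▸ Set.subset_union_left)
  have hQd : Disjoint Xᶜ Q :=
    Set.disjoint_compl_left_iff_subset.2 (hPQ ▸ Set.subset_union_right)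
  rcases joins_or_joins hPQ he₁ with hj₁ | hj₁ <;> rcases joins_or_joins hPQ he₂ with hj₂ | hj₂
  · exact Or.inl ⟨_, ⟨P, hP, rfl⟩, hj₁.mem_crossEdges subset_rfl hPd,
      hj₂.mem_crossEdges subset_rfl hPd, hj.mem_crossEdges subset_rfl hd.symm⟩
  · exact Or.inr ⟨_, _, isTriangle_of_joins hX hP hQ hPQ hd hj₁ hj₂ hj⟩
  · exact Or.inr ⟨_, _, isTriangle_of_joins hX hQ hP (Set.union_comm P Q ▸ hPQ) hd.symm hj₁ hj₂
      hj.symm⟩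
  · exact Or.inl ⟨_, ⟨Q, hQ, rfl⟩, hj₁.mem_crossEdges subset_rfl hQd,
      hj₂.mem_crossEdges subset_rfl hQd, hj.symm.mem_crossEdges subset_rfl hd⟩

lemma IsBond.not_isLoop {B : Set Γ.E} (hB : Γ.IsBond B) {e : Γ.E} (he : e ∈ B) :
    ¬ Γ.IsLoop e := by
  obtain ⟨W, -, rfl⟩ := hB
  exact not_isLoop_of_mem_crossEdges he

open Classical in
/-- The element `(e^∨ − f^∨)_B`. -/
noncomputable def bondDiff (Γ : Multigraph) (B : Set Γ.E) (e f : Γ.E) : Set Γ.E → Γ.E → ℤ :=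
  fun B' e' => if B' = B then Γ.kdelta e e' - Γ.kdelta f e' else 0

lemma gen1_eq (B₁ B₂ : Set Γ.E) (e₁ e₂ : Γ.E) :
    Γ.gen1 B₁ B₂ e₁ e₂ = Γ.bondDiff B₁ e₁ e₂ + Γ.bondDiff B₂ e₂ e₁ := rfl

lemma gen2_eq (B₁ B₂ B₃ : Set Γ.E) (e₁ e₂ e₃ : Γ.E) :
    Γ.gen2 B₁ B₂ B₃ e₁ e₂ e₃ =
      Γ.bondDiff B₁ e₁ e₂ + Γ.bondDiff B₂ e₂ e₃ + Γ.bondDiff B₃ e₃ e₁ := rfl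

lemma bondDiff_add_bondDiff (B : Set Γ.E) (e f g : Γ.E) :
    Γ.bondDiff B e f + Γ.bondDiff B f g = Γ.bondDiff B e g := by
  funext B' e'
  simp only [bondDiff, Pi.add_apply]
  split_ifs <;> ring

lemma bondDiff_self (B : Set Γ.E) (e : Γ.E) : Γ.bondDiff B e e = 0 := by
  funext B' e'
  simp [bondDiff]

/-- The two families of relations of the kernel. -/
def relations (Γ : Multigraph) : Set (Set Γ.E → Γ.E → ℤ) :=
  {L : Set Γ.E → Γ.E → ℤ | ∃ (B₁ B₂ : Set Γ.E) (e₁ e₂ : Γ.E),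
      Γ.IsBond B₁ ∧ Γ.IsBond B₂ ∧ e₁ ∈ B₁ ∩ B₂ ∧ e₂ ∈ B₁ ∩ B₂ ∧
      L = Γ.gen1 B₁ B₂ e₁ e₂} ∪
  {L : Set Γ.E → Γ.E → ℤ | ∃ (V₁ V₂ : Set Γ.V) (e₁ e₂ e₃ : Γ.E),
      V₁ ∩ V₂ = ∅ ∧
      Γ.IsBondOn V₁ ∧ Γ.IsBondOn V₂ ∧ Γ.IsBondOn (V₁ ∪ V₂) ∧
      e₁ ∈ Γ.crossEdges V₁ ∩ Γ.crossEdges (V₁ ∪ V₂) ∧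
      e₂ ∈ Γ.crossEdges V₁ ∩ Γ.crossEdges V₂ ∧
      e₃ ∈ Γ.crossEdges V₂ ∩ Γ.crossEdges (V₁ ∪ V₂) ∧
      L = Γ.gen2 (Γ.crossEdges V₁) (Γ.crossEdges V₂) (Γ.crossEdges (V₁ ∪ V₂)) e₁ e₂ e₃}

/-- The class of `(e^∨ − f^∨)_B` modulo the relations. -/
noncomputable def bondClass (Γ : Multigraph) (B : Set Γ.E) (e f : Γ.E) :
    (Set Γ.E → Γ.E → ℤ) ⧸ Submodule.span ℤ Γ.relations :=
  (Submodule.span ℤ Γ.relations).mkQ (Γ.bondDiff B e f)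

lemma bondClass_add_bondClass (B : Set Γ.E) (e f g : Γ.E) :
    Γ.bondClass B e f + Γ.bondClass B f g = Γ.bondClass B e g := by
  rw [bondClass, bondClass, ← map_add, bondDiff_add_bondDiff, bondClass]

lemma bondClass_self (B : Set Γ.E) (e : Γ.E) : Γ.bondClass B e e = 0 := by
  rw [bondClass, bondDiff_self, map_zero]

lemma bondClass_swap (B : Set Γ.E) (e f : Γ.E) : Γ.bondClass B e f = -Γ.bondClass B f e := by
  rw [eq_neg_iff_add_eq_zero, bondClass_add_bondClass, bondClass_self]

lemma mkQ_eq_zero_of_mem_relations {L : Set Γ.E → Γ.E → ℤ} (h : L ∈ Γ.relations) :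
    (Submodule.span ℤ Γ.relations).mkQ L = 0 := by
  rw [Submodule.mkQ_apply, Submodule.Quotient.mk_eq_zero]
  exact Submodule.subset_span h

lemma bondClass_congr {B₁ B₂ : Set Γ.E} {e f : Γ.E} (h₁ : Γ.IsBond B₁) (h₂ : Γ.IsBond B₂)
    (he₁ : e ∈ B₁) (he₂ : e ∈ B₂) (hf₁ : f ∈ B₁) (hf₂ : f ∈ B₂) :
    Γ.bondClass B₁ e f = Γ.bondClass B₂ e f := by
  rw [bondClass_swap B₂, eq_neg_iff_add_eq_zero, bondClass, bondClass, ← map_add, ← gen1_eq]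
  exact mkQ_eq_zero_of_mem_relations
    (Or.inl ⟨B₁, B₂, e, f, h₁, h₂, ⟨he₁, he₂⟩, ⟨hf₁, hf₂⟩, rfl⟩)

lemma Biconnected.bondClass_cocycle (hΓ : Γ.Biconnected) {B₁ B₂ B₃ : Set Γ.E} {e f g : Γ.E}
    (h₁ : Γ.IsBond B₁) (h₂ : Γ.IsBond B₂) (h₃ : Γ.IsBond B₃) (he₁ : e ∈ B₁) (hf₁ : f ∈ B₁)
    (hf₂ : f ∈ B₂) (hg₂ : g ∈ B₂) (hg₃ : g ∈ B₃) (he₃ : e ∈ B₃) :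
    Γ.bondClass B₁ e f + Γ.bondClass B₂ f g + Γ.bondClass B₃ g e = 0 := by
  rcases hΓ.exists_isBond_or_isTriangle (h₁.not_isLoop he₁) (h₁.not_isLoop hf₁)
    (h₂.not_isLoop hg₂) with ⟨B, hB, he, hf, hg⟩ | ⟨V₁, V₂, hd, hV₁, hV₂, hV₃, he, hf, hg⟩
  · rw [bondClass_congr h₁ hB he₁ he hf₁ hf, bondClass_congr h₂ hB hf₂ hf hg₂ hg,
      bondClass_congr h₃ hB hg₃ hg he₃ he, bondClass_add_bondClass, bondClass_add_bondClass,
      bondClass_self]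
  · rw [bondClass_congr h₁ ⟨V₁, hV₁, rfl⟩ he₁ he.1 hf₁ hf.1,
      bondClass_congr h₂ ⟨V₂, hV₂, rfl⟩ hf₂ hf.2 hg₂ hg.1,
      bondClass_congr h₃ ⟨V₁ ∪ V₂, hV₃, rfl⟩ hg₃ hg.2 he₃ he.2, bondClass, bondClass, bondClass,
      ← map_add, ← map_add, ← gen2_eq]
    exact mkQ_eq_zero_of_mem_relations
      (Or.inr ⟨V₁, V₂, e, f, g, hd, hV₁, hV₂, hV₃, he, hf, hg, rfl⟩)

/-- Modulo the relations, the differences `(e^∨ − f^∨)_B` come from a potential on the edges. -/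
lemma Biconnected.exists_potential (hΓ : Γ.Biconnected) :
    ∃ φ : Γ.E → (Set Γ.E → Γ.E → ℤ) ⧸ Submodule.span ℤ Γ.relations,
      ∀ B, Γ.IsBond B → ∀ e ∈ B, ∀ f ∈ B, Γ.bondClass B e f = φ e - φ f := by
  by_cases h : ∃ e₀ : Γ.E, ¬ Γ.IsLoop e₀
  · obtain ⟨e₀, he₀⟩ := h
    have hex : ∀ e : Γ.E, ∃ B, ¬ Γ.IsLoop e → Γ.IsBond B ∧ e ∈ B ∧ e₀ ∈ B := fun e => by
      by_cases he : Γ.IsLoop e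
      · exact ⟨∅, fun h => absurd he h⟩
      · obtain ⟨B, hB⟩ := hΓ.exists_isBond he he₀
        exact ⟨B, fun _ => hB⟩
    choose β hβ using hex
    refine ⟨fun e => Γ.bondClass (β e) e e₀, fun B hB e he f hf => ?_⟩
    obtain ⟨h₁, h₂, h₃⟩ := hβ e (hB.not_isLoop he)
    obtain ⟨h₁', h₂', h₃'⟩ := hβ f (hB.not_isLoop hf)
    have := hΓ.bondClass_cocycle hB h₁' h₁ he hf h₂' h₃' h₃ h₂
    rw [bondClass_swap (β e)] at this
    rw [← sub_eq_zero, ← this]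
    abel
  · push Not at h
    exact ⟨0, fun B hB e he => absurd (h e) (hB.not_isLoop he)⟩

lemma sum_kdelta [Fintype Γ.E] (e : Γ.E) : ∑ e' : Γ.E, Γ.kdelta e e' = 1 := by
  classical
  simp [kdelta]

/-- The kernel of `r^∨`, as a submodule of the space of all families. -/
noncomputable def bondKernel (Γ : Multigraph) : Submodule ℤ (Set Γ.E → Γ.E → ℤ) where
  carrier := {L : Set Γ.E → Γ.E → ℤ |
    (∀ (B : Set Γ.E) (e : Γ.E), ¬ (Γ.IsBond B ∧ e ∈ B) → L B e = 0) ∧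
    (∀ B : Set Γ.E, ∑ᶠ e : Γ.E, L B e = 0) ∧
    (∀ e : Γ.E, ∑ᶠ B : Set Γ.E, L B e = 0)}
  zero_mem' := by simp
  add_mem' := by
    rintro L M ⟨h₁, h₂, h₃⟩ ⟨h₁', h₂', h₃'⟩
    refine ⟨fun B e h => ?_, fun B => ?_, fun e => ?_⟩
    · simp [h₁ B e h, h₁' B e h]
    · simp [finsum_add_distrib (Set.toFinite _) (Set.toFinite _), h₂, h₂']
    · simp [finsum_add_distrib (Set.toFinite _) (Set.toFinite _), h₃, h₃']
  smul_mem' := by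
    rintro c L ⟨h₁, h₂, h₃⟩
    refine ⟨fun B e h => ?_, fun B => ?_, fun e => ?_⟩
    · simp [h₁ B e h]
    · simp [← mul_finsum, h₂]
    · simp [← mul_finsum, h₃]

lemma kdelta_eq_zero {B : Set Γ.E} {e e' : Γ.E} (he : e ∈ B) (he' : e' ∉ B) :
    Γ.kdelta e e' = 0 := by
  classical
  exact if_neg fun h : e = e' => he' (h ▸ he)

lemma bondDiff_eq_zero {B : Set Γ.E} (hB : Γ.IsBond B) {e f : Γ.E} (he : e ∈ B) (hf : f ∈ B)
    (B' : Set Γ.E) (e' : Γ.E) (h : ¬ (Γ.IsBond B' ∧ e' ∈ B')) : Γ.bondDiff B e f B' e' = 0 := by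
  classical
  unfold bondDiff
  split_ifs with hB'
  · subst hB'
    have he' : e' ∉ B' := fun h' => h ⟨hB, h'⟩
    rw [kdelta_eq_zero he he', kdelta_eq_zero hf he', sub_zero]
  · rfl

lemma sum_edge_bondDiff [Fintype Γ.E] (B : Set Γ.E) (e f : Γ.E) (B' : Set Γ.E) :
    ∑ e', Γ.bondDiff B e f B' e' = 0 := by
  classical
  unfold bondDiff
  split_ifs
  · rw [Finset.sum_sub_distrib, sum_kdelta, sum_kdelta, sub_self]
  · simp

lemma sum_bond_bondDiff [Fintype (Set Γ.E)] (B : Set Γ.E) (e f e' : Γ.E) :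
    ∑ B', Γ.bondDiff B e f B' e' = Γ.kdelta e e' - Γ.kdelta f e' := by
  classical
  simp [bondDiff]

lemma relations_subset_bondKernel : Γ.relations ⊆ Γ.bondKernel := by
  classical
  have := Fintype.ofFinite Γ.E
  rintro L (⟨B₁, B₂, e₁, e₂, h₁, h₂, he₁, he₂, rfl⟩ |
    ⟨V₁, V₂, e₁, e₂, e₃, -, h₁, h₂, h₃, he₁, he₂, he₃, rfl⟩)
  · rw [gen1_eq]
    refine ⟨fun B e h => ?_, fun B => ?_, fun e => ?_⟩
    · simp [bondDiff_eq_zero h₁ he₁.1 he₂.1 B e h, bondDiff_eq_zero h₂ he₂.2 he₁.2 B e h]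
    · simp [finsum_eq_sum_of_fintype, Finset.sum_add_distrib, sum_edge_bondDiff]
    · simp [finsum_eq_sum_of_fintype, Finset.sum_add_distrib, sum_bond_bondDiff]
  · rw [gen2_eq]
    refine ⟨fun B e h => ?_, fun B => ?_, fun e => ?_⟩
    · simp [bondDiff_eq_zero ⟨V₁, h₁, rfl⟩ he₁.1 he₂.1 B e h,
        bondDiff_eq_zero ⟨V₂, h₂, rfl⟩ he₂.2 he₃.1 B e h,
        bondDiff_eq_zero ⟨_, h₃, rfl⟩ he₃.2 he₁.2 B e h]
    · simp [finsum_eq_sum_of_fintype, Finset.sum_add_distrib, sum_edge_bondDiff]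
    · simp [finsum_eq_sum_of_fintype, Finset.sum_add_distrib, sum_bond_bondDiff]

lemma eq_sum_bondDiff [Fintype Γ.E] [Fintype (Set Γ.E)] {L : Set Γ.E → Γ.E → ℤ}
    (hL : ∀ B, ∑ e, L B e = 0) (b : Set Γ.E → Γ.E) :
    L = ∑ B, ∑ e, L B e • Γ.bondDiff B e (b B) := by
  classical
  funext B' e'
  simp only [Finset.sum_apply, Pi.smul_apply, smul_eq_mul]
  rw [Finset.sum_eq_single B' (fun B _ hB => by simp [bondDiff, hB.symm]) (by simp)]
  simp [bondDiff, mul_sub, hL, kdelta]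

lemma Biconnected.bondKernel_le (hΓ : Γ.Biconnected) :
    Γ.bondKernel ≤ Submodule.span ℤ Γ.relations := by
  classical
  have := Fintype.ofFinite Γ.E
  rintro L ⟨h₁, h₂, h₃⟩
  simp only [finsum_eq_sum_of_fintype] at h₂ h₃
  rcases isEmpty_or_nonempty Γ.E with hE | ⟨⟨e₀⟩⟩
  · rw [Subsingleton.elim L 0]
    exact zero_mem _
  obtain ⟨φ, hφ⟩ := hΓ.exists_potential
  obtain ⟨b, hb⟩ : ∃ b : Set Γ.E → Γ.E, ∀ B, ∀ e ∈ B, b B ∈ B :=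
    ⟨fun B => if h : B.Nonempty then h.some else e₀, fun B e he => by
      have h : B.Nonempty := ⟨e, he⟩
      simpa only [dif_pos h] using h.some_mem⟩
  rw [← Submodule.Quotient.mk_eq_zero, ← Submodule.mkQ_apply, eq_sum_bondDiff h₂ b]
  have hterm : ∀ B e, L B e • Γ.bondClass B e (b B) = L B e • φ e - L B e • φ (b B) := by
    intro B e
    by_cases h : Γ.IsBond B ∧ e ∈ B
    · rw [hφ B h.1 e h.2 _ (hb B e h.2), smul_sub]
    · simp [h₁ B e h]
  calc (Submodule.span ℤ Γ.relations).mkQ (∑ B, ∑ e, L B e • Γ.bondDiff B e (b B))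
      = ∑ B, ∑ e, L B e • Γ.bondClass B e (b B) := by simp only [map_sum, map_smul, bondClass]
    _ = ∑ e, (∑ B, L B e) • φ e - ∑ B, (∑ e, L B e) • φ (b B) := by
        simp only [hterm, Finset.sum_sub_distrib, Finset.sum_smul]
        rw [Finset.sum_comm]
    _ = 0 := by simp [h₂, h₃]

end Multigraph

/-- Lemma 5.3: for a biconnected `Γ`, under the identification of
`(ℤ^B/U_B)^∨` with `{ℓ : B → ℤ | Σ ℓ = 0}` (an element of the direct sum over all bonds
being a function `L` with `L B` supported on `B` and of coordinate sum zero for each bond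
`B`, and zero for non-bonds), the kernel of `r^∨` — i.e. the set of such `L` with
`Σ_B L B e = 0` for every edge `e` — is the `ℤ`-span of the type-1 and type-2
generators. -/
theorem kernel_generated_by_gen1_gen2 (Γ : Multigraph) (hΓ : Γ.Biconnected) :
    {L : Set Γ.E → Γ.E → ℤ |
        (∀ (B : Set Γ.E) (e : Γ.E), ¬ (Γ.IsBond B ∧ e ∈ B) → L B e = 0) ∧
        (∀ B : Set Γ.E, ∑ᶠ e : Γ.E, L B e = 0) ∧
        (∀ e : Γ.E, ∑ᶠ B : Set Γ.E, L B e = 0)} =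
      ↑(Submodule.span ℤ
        ({L : Set Γ.E → Γ.E → ℤ | ∃ (B₁ B₂ : Set Γ.E) (e₁ e₂ : Γ.E),
            Γ.IsBond B₁ ∧ Γ.IsBond B₂ ∧ e₁ ∈ B₁ ∩ B₂ ∧ e₂ ∈ B₁ ∩ B₂ ∧
            L = Γ.gen1 B₁ B₂ e₁ e₂} ∪
         {L : Set Γ.E → Γ.E → ℤ | ∃ (V₁ V₂ : Set Γ.V) (e₁ e₂ e₃ : Γ.E),
            V₁ ∩ V₂ = ∅ ∧
            Γ.IsBondOn V₁ ∧ Γ.IsBondOn V₂ ∧ Γ.IsBondOn (V₁ ∪ V₂) ∧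
            e₁ ∈ Γ.crossEdges V₁ ∩ Γ.crossEdges (V₁ ∪ V₂) ∧
            e₂ ∈ Γ.crossEdges V₁ ∩ Γ.crossEdges V₂ ∧
            e₃ ∈ Γ.crossEdges V₂ ∩ Γ.crossEdges (V₁ ∪ V₂) ∧
            L = Γ.gen2 (Γ.crossEdges V₁) (Γ.crossEdges V₂) (Γ.crossEdges (V₁ ∪ V₂))
                  e₁ e₂ e₃})) := by
  exact congrArg SetLike.coe (le_antisymm hΓ.bondKernel_le
    (Submodule.span_le.2 Multigraph.relations_subset_bondKernel))
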